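/- Let A ≥ 1, let (X,d) be an unbounded A-uniform metric space with d(x) > 0 for every x ∈ X, let k be its quasihyperbolic metric, let p ∈ X and let a ∈ ∂X. Then (x|y)^k_p → ∞ as x, y → a in the metric topology; i.e. for every M > 0 there exists r > 0 such that whenever x, y ∈ X satisfy d̄(x,a) < r and d̄(y,a) < r (d̄ the distance in the completion X̄), one has (x|y)^k_p ≥ M. -/

import Mathlib

open Metric Filter Set

noncomputable section

universe u v

/-- Gromov product of `x` and `y` with respect to base point `w`,
for a real-valued distance kernel `ρ`. -/
def gromovProd {X : Type u} (ρ : X → X → ℝ) (w x y : X) : ℝ :=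
  (ρ x w + ρ y w - ρ x y) / 2

/-- `(X, ρ)` is δ-hyperbolic. -/
def IsDeltaHyp {X : Type u} (ρ : X → X → ℝ) (δ : ℝ) : Prop :=
  ∀ x y z w : X, gromovProd ρ w x y ≥ min (gromovProd ρ w x z) (gromovProd ρ w z y) - δ

/-- `f` is a (λ,μ)-rough similarity. -/
def RoughSimilarity {X : Type u} {Y : Type v} [MetricSpace X] [MetricSpace Y]
    (lam mu : ℝ) (f : X → Y) : Prop :=
  (∀ y : Y, ∃ x : X, dist y (f x) ≤ mu) ∧
  (∀ x x' : X, lam * dist x x' - mu ≤ dist (f x) (f x') ∧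
    dist (f x) (f x') ≤ lam * dist x x' + mu)

/-- The distance from `x ∈ X` to the metric boundary `∂X = X̄ \ X`. -/
def distToBdry (X : Type u) [MetricSpace X] (x : X) : ℝ :=
  Metric.infDist (x : UniformSpace.Completion X)
    (Set.range ((↑) : X → UniformSpace.Completion X))ᶜ

/-- `X` is noncomplete, i.e. `∂X = X̄ \ X ≠ ∅`. -/
def IsNoncomplete (X : Type u) [MetricSpace X] : Prop :=
  ((Set.range ((↑) : X → UniformSpace.Completion X))ᶜ).Nonempty

/-- Ibragimov's hyperbolization metric. -/
def hMetric (X : Type u) [MetricSpace X] (x y : X) : ℝ :=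
  2 * Real.log ((dist x y + max (distToBdry X x) (distToBdry X y)) /
    Real.sqrt (distToBdry X x * distToBdry X y))

/-- The j̃-metric. -/
def jtMetric (X : Type u) [MetricSpace X] (x y : X) : ℝ :=
  (1 / 2) * Real.log ((1 + dist x y / distToBdry X x) * (1 + dist x y / distToBdry X y))

/-- The quasihyperbolic metric. -/
def quasihyperbolic (X : Type u) [MetricSpace X] (x y : X) : ℝ :=
  sInf {r : ℝ | ∃ L : ℝ, 0 ≤ L ∧ ∃ γ : ℝ → X,
    LipschitzOnWith 1 γ (Set.Icc 0 L) ∧ γ 0 = x ∧ γ L = y ∧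
    r = ∫ t in (0:ℝ)..L, (distToBdry X (γ t))⁻¹}

/-- `X` is an `A`-uniform metric space. -/
def IsUniformMS (X : Type u) [MetricSpace X] (A : ℝ) : Prop :=
  ∀ x y : X, ∃ L : ℝ, 0 ≤ L ∧ ∃ γ : ℝ → X,
    LipschitzOnWith 1 γ (Set.Icc 0 L) ∧ γ 0 = x ∧ γ L = y ∧
    L ≤ A * dist x y ∧ ∀ t ∈ Set.Icc (0:ℝ) L, min t (L - t) ≤ A * distToBdry X (γ t)

/-- `X` is unbounded. -/
def IsUnbounded (X : Type u) [MetricSpace X] : Prop :=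
  ¬ Bornology.IsBounded (Set.univ : Set X)

/-- The quasihyperbolic lengths of the 1-Lipschitz curves from `x` to `y`. -/
def quasihyperbolicLengths (X : Type u) [MetricSpace X] (x y : X) : Set ℝ :=
  {r : ℝ | ∃ L : ℝ, 0 ≤ L ∧ ∃ γ : ℝ → X,
    LipschitzOnWith 1 γ (Set.Icc 0 L) ∧ γ 0 = x ∧ γ L = y ∧
    r = ∫ t in (0:ℝ)..L, (distToBdry X (γ t))⁻¹}

section Quasihyperbolic

variable {X : Type u} [MetricSpace X]

theorem distToBdry_le_add_dist (x y : X) : distToBdry X x ≤ distToBdry X y + dist x y := by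
  unfold distToBdry
  rw [← UniformSpace.Completion.dist_eq]
  exact Metric.infDist_le_infDist_add_dist

theorem continuous_distToBdry : Continuous (distToBdry X) :=
  (Metric.continuous_infDist_pt _).comp (UniformSpace.Completion.continuous_coe X)

theorem distToBdry_le_dist {a : UniformSpace.Completion X}
    (ha : a ∈ (Set.range ((↑) : X → UniformSpace.Completion X))ᶜ) (x : X) :
    distToBdry X x ≤ dist (x : UniformSpace.Completion X) a :=
  Metric.infDist_le_dist_of_mem ha

theorem dist_le_sub_of_lipschitzOnWith_one {γ : ℝ → X} {S : Set ℝ} (hγ : LipschitzOnWith 1 γ S)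
    {s t : ℝ} (hs : s ∈ S) (ht : t ∈ S) (hst : s ≤ t) : dist (γ s) (γ t) ≤ t - s := by
  have h := hγ.dist_le_mul s hs t ht
  rw [Real.dist_eq, abs_sub_comm, abs_of_nonneg (by linarith)] at h
  simpa using h

theorem lipschitzOnWith_one_of_dist_le_sub {γ : ℝ → X} {S : Set ℝ}
    (h : ∀ s ∈ S, ∀ t ∈ S, s ≤ t → dist (γ s) (γ t) ≤ t - s) : LipschitzOnWith 1 γ S := by
  refine LipschitzOnWith.of_dist_le_mul fun s hs t ht => ?_
  rw [Real.dist_eq, NNReal.coe_one, one_mul]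
  rcases le_total s t with hst | hst
  · rw [abs_sub_comm, abs_of_nonneg (by linarith)]
    exact h s hs t ht hst
  · rw [dist_comm, abs_of_nonneg (by linarith)]
    exact h t ht s hs hst

theorem continuousOn_inv_distToBdry_comp (hd : ∀ x : X, 0 < distToBdry X x) {γ : ℝ → X}
    {S : Set ℝ} (hγ : ContinuousOn γ S) : ContinuousOn (fun t => (distToBdry X (γ t))⁻¹) S :=
  (continuous_distToBdry.comp_continuousOn hγ).inv₀ fun t _ => (hd (γ t)).ne'

theorem intervalIntegrable_inv_distToBdry_comp (hd : ∀ x : X, 0 < distToBdry X x) {γ : ℝ → X}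
    {L s t : ℝ} (hγ : LipschitzOnWith 1 γ (Icc 0 L)) (hs : 0 ≤ s) (hst : s ≤ t) (ht : t ≤ L) :
    IntervalIntegrable (fun τ => (distToBdry X (γ τ))⁻¹) MeasureTheory.volume s t :=
  ((continuousOn_inv_distToBdry_comp hd hγ.continuousOn).mono
    (Icc_subset_Icc hs ht)).intervalIntegrable_of_Icc hst

theorem quasihyperbolicLengths_nonneg (hd : ∀ x : X, 0 < distToBdry X x) {x y : X} {r : ℝ}
    (hr : r ∈ quasihyperbolicLengths X x y) : 0 ≤ r := by
  obtain ⟨L, hL, γ, -, -, -, rfl⟩ := hr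
  exact intervalIntegral.integral_nonneg hL fun t _ => (inv_pos.2 (hd _)).le

theorem bddBelow_quasihyperbolicLengths (hd : ∀ x : X, 0 < distToBdry X x) (x y : X) :
    BddBelow (quasihyperbolicLengths X x y) :=
  ⟨0, fun _ hr => quasihyperbolicLengths_nonneg hd hr⟩

theorem quasihyperbolic_le_of_mem (hd : ∀ x : X, 0 < distToBdry X x) {x y : X} {r : ℝ}
    (hr : r ∈ quasihyperbolicLengths X x y) : quasihyperbolic X x y ≤ r :=
  csInf_le (bddBelow_quasihyperbolicLengths hd x y) hr

theorem IsUniformMS.quasihyperbolicLengths_nonempty {A : ℝ} (hXA : IsUniformMS X A) (x y : X) :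
    (quasihyperbolicLengths X x y).Nonempty := by
  obtain ⟨L, hL, γ, hγ, h0, h1, -, -⟩ := hXA x y
  exact ⟨_, L, hL, γ, hγ, h0, h1, rfl⟩

theorem integral_mem_quasihyperbolicLengths {γ : ℝ → X} {L s t : ℝ}
    (hγ : LipschitzOnWith 1 γ (Icc 0 L)) (hs : 0 ≤ s) (hst : s ≤ t) (ht : t ≤ L) :
    (∫ τ in s..t, (distToBdry X (γ τ))⁻¹) ∈ quasihyperbolicLengths X (γ s) (γ t) := by
  refine ⟨t - s, by linarith, fun τ => γ (τ + s), ?_, by simp, by simp, ?_⟩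
  · refine lipschitzOnWith_one_of_dist_le_sub fun u hu v hv huv => ?_
    have := dist_le_sub_of_lipschitzOnWith_one hγ (s := u + s) (t := v + s)
      ⟨by linarith [hu.1], by linarith [hu.2]⟩ ⟨by linarith [hv.1], by linarith [hv.2]⟩
      (by linarith)
    linarith
  · rw [intervalIntegral.integral_comp_add_right (fun τ => (distToBdry X (γ τ))⁻¹)]
    simp

theorem quasihyperbolicLengths_symm {x y : X} {r : ℝ}
    (hr : r ∈ quasihyperbolicLengths X x y) : r ∈ quasihyperbolicLengths X y x := by
  obtain ⟨L, hL, γ, hγ, h0, h1, rfl⟩ := hr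
  refine ⟨L, hL, fun τ => γ (L - τ), ?_, by simpa, by simpa, ?_⟩
  · refine lipschitzOnWith_one_of_dist_le_sub fun u hu v hv huv => ?_
    have := dist_le_sub_of_lipschitzOnWith_one hγ (s := L - v) (t := L - u)
      ⟨by linarith [hv.2], by linarith [hv.1]⟩ ⟨by linarith [hu.2], by linarith [hu.1]⟩
      (by linarith)
    rw [dist_comm]
    linarith
  · rw [intervalIntegral.integral_comp_sub_left (fun τ => (distToBdry X (γ τ))⁻¹)]
    simp

theorem quasihyperbolic_comm (x y : X) : quasihyperbolic X x y = quasihyperbolic X y x :=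
  congrArg sInf (Set.ext fun _ =>
    ⟨fun h => quasihyperbolicLengths_symm h, fun h => quasihyperbolicLengths_symm h⟩)

theorem add_mem_quasihyperbolicLengths (hd : ∀ x : X, 0 < distToBdry X x) {x y z : X} {r s : ℝ}
    (hr : r ∈ quasihyperbolicLengths X x y) (hs : s ∈ quasihyperbolicLengths X y z) :
    r + s ∈ quasihyperbolicLengths X x z := by
  obtain ⟨L, hL, γ, hγ, h0, h1, rfl⟩ := hr
  obtain ⟨L', hL', γ', hγ', h0', h1', rfl⟩ := hs
  set σ : ℝ → X := fun τ => if τ ≤ L then γ τ else γ' (τ - L) with hσ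
  have hleft : ∀ τ ≤ L, σ τ = γ τ := fun τ hτ => if_pos hτ
  have hright : ∀ τ, L ≤ τ → σ τ = γ' (τ - L) := by
    intro τ hτ
    rcases hτ.eq_or_lt with rfl | hτ
    · simp [hσ, h1, h0']
    · exact if_neg hτ.not_ge
  have hlip : LipschitzOnWith 1 σ (Icc 0 (L + L')) := by
    refine lipschitzOnWith_one_of_dist_le_sub fun u hu v hv huv => ?_
    have left : ∀ u v, 0 ≤ u → u ≤ v → v ≤ L → dist (σ u) (σ v) ≤ v - u := by
      intro u v hu huv hv
      rw [hleft u (huv.trans hv), hleft v hv]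
      exact dist_le_sub_of_lipschitzOnWith_one hγ ⟨hu, by linarith⟩ ⟨by linarith, hv⟩ huv
    have right : ∀ u v, L ≤ u → u ≤ v → v ≤ L + L' → dist (σ u) (σ v) ≤ v - u := by
      intro u v hu huv hv
      rw [hright u hu, hright v (hu.trans huv)]
      have := dist_le_sub_of_lipschitzOnWith_one hγ' (s := u - L) (t := v - L)
        ⟨by linarith, by linarith⟩ ⟨by linarith, by linarith⟩ (by linarith)
      linarith
    rcases le_total v L with h | h
    · exact left u v hu.1 huv h
    rcases le_total L u with h' | h'
    · exact right u v h' huv hv.2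
    · linarith [left u L hu.1 h' le_rfl, right L v le_rfl h hv.2, dist_triangle (σ u) (σ L) (σ v)]
  refine ⟨L + L', by linarith, σ, hlip, ?_, ?_, ?_⟩
  · rw [hleft 0 hL, h0]
  · rw [hright _ (by linarith), add_sub_cancel_left, h1']
  · rw [← intervalIntegral.integral_add_adjacent_intervals
      (intervalIntegrable_inv_distToBdry_comp hd hlip le_rfl hL (by linarith))
      (intervalIntegrable_inv_distToBdry_comp hd hlip hL (by linarith) le_rfl)]
    congr 1
    · refine intervalIntegral.integral_congr fun τ hτ => ?_
      rw [uIcc_of_le hL] at hτ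
      simp only [hleft τ hτ.2]
    · have : ∫ τ in L..(L + L'), (distToBdry X (σ τ))⁻¹ =
          ∫ τ in L..(L + L'), (distToBdry X (γ' (τ - L)))⁻¹ := by
        refine intervalIntegral.integral_congr fun τ hτ => ?_
        rw [uIcc_of_le (by linarith)] at hτ
        simp only [hright τ hτ.1]
      rw [this, intervalIntegral.integral_comp_sub_right (fun τ => (distToBdry X (γ' τ))⁻¹)]
      simp

theorem IsUniformMS.quasihyperbolic_triangle {A : ℝ} (hXA : IsUniformMS X A)
    (hd : ∀ x : X, 0 < distToBdry X x) (x y z : X) :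
    quasihyperbolic X x z ≤ quasihyperbolic X x y + quasihyperbolic X y z := by
  refine le_of_forall_pos_le_add fun ε hε => ?_
  obtain ⟨r, hr, hr'⟩ := exists_lt_of_csInf_lt (hXA.quasihyperbolicLengths_nonempty x y)
    (show quasihyperbolic X x y < quasihyperbolic X x y + ε / 2 by linarith)
  obtain ⟨s, hs, hs'⟩ := exists_lt_of_csInf_lt (hXA.quasihyperbolicLengths_nonempty y z)
    (show quasihyperbolic X y z < quasihyperbolic X y z + ε / 2 by linarith)
  linarith [quasihyperbolic_le_of_mem hd (add_mem_quasihyperbolicLengths hd hr hs)]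

theorem integral_inv_add_eq_log {w L : ℝ} (hw : 0 < w) (hL : 0 ≤ L) :
    ∫ t in (0:ℝ)..L, (w + t)⁻¹ = Real.log (1 + L / w) := by
  have h := intervalIntegral.integral_comp_add_left (a := 0) (b := L) (fun t : ℝ => t⁻¹) w
  rw [h, integral_inv_of_pos (by linarith) (by linarith)]
  congr 1
  field_simp
  ring

theorem IsUniformMS.log_div_le_quasihyperbolic {A : ℝ} (hXA : IsUniformMS X A)
    (hd : ∀ x : X, 0 < distToBdry X x) (x y : X) :
    Real.log (distToBdry X y / distToBdry X x) ≤ quasihyperbolic X x y := by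
  refine le_csInf (hXA.quasihyperbolicLengths_nonempty x y) ?_
  rintro r ⟨L, hL, γ, hγ, rfl, rfl, rfl⟩
  have hbound : ∀ t ∈ Icc 0 L, distToBdry X (γ t) ≤ distToBdry X (γ 0) + t := by
    intro t ht
    have h1 := dist_le_sub_of_lipschitzOnWith_one hγ ⟨le_rfl, hL⟩ ht ht.1
    have h2 := distToBdry_le_add_dist (γ t) (γ 0)
    rw [dist_comm] at h2
    linarith
  have h0 := hd (γ 0)
  calc Real.log (distToBdry X (γ L) / distToBdry X (γ 0))
      ≤ Real.log (1 + L / distToBdry X (γ 0)) := by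
        refine Real.log_le_log (div_pos (hd _) h0) ?_
        rw [div_le_iff₀ h0, add_mul, div_mul_cancel₀ _ h0.ne', one_mul]
        exact hbound L ⟨hL, le_rfl⟩
    _ = ∫ t in (0:ℝ)..L, (distToBdry X (γ 0) + t)⁻¹ := (integral_inv_add_eq_log h0 hL).symm
    _ ≤ _ := by
        refine intervalIntegral.integral_mono_on hL ?_
          (intervalIntegrable_inv_distToBdry_comp hd hγ le_rfl hL le_rfl) fun t ht => ?_
        · refine ContinuousOn.intervalIntegrable_of_Icc hL (ContinuousOn.inv₀ (by fun_prop) ?_)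
          intro t ht
          linarith [ht.1]
        · exact inv_anti₀ (hd _) (hbound t ht)

theorem IsUniformMS.quasihyperbolic_le_log {A : ℝ} (hA : 1 ≤ A) (hXA : IsUniformMS X A)
    (hd : ∀ x : X, 0 < distToBdry X x) {x y : X} {w ℓ : ℝ} (hw : 0 < w)
    (hx : w ≤ distToBdry X x) (hy : w ≤ distToBdry X y) (hℓ : dist x y ≤ ℓ) :
    quasihyperbolic X x y ≤ 6 * A * Real.log (1 + A * ℓ / w) := by
  obtain ⟨L, hL, γ, hγ, rfl, rfl, hLA, hmin⟩ := hXA x y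
  have hcont₁ : ContinuousOn (fun t : ℝ => (w + t)⁻¹) (Icc 0 L) :=
    ContinuousOn.inv₀ (by fun_prop) fun t ht => by linarith [ht.1]
  have hcont₂ : ContinuousOn (fun t : ℝ => (w + (L - t))⁻¹) (Icc 0 L) :=
    ContinuousOn.inv₀ (by fun_prop) fun t ht => by linarith [ht.2]
  have hlower : ∀ t ∈ Icc 0 L, ∀ τ, 0 ≤ τ → τ ≤ A * distToBdry X (γ t) →
      w - τ ≤ distToBdry X (γ t) → (distToBdry X (γ t))⁻¹ ≤ 3 * A * (w + τ)⁻¹ := by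
    intro t _ τ hτ h1 h2
    have hpos := hd (γ t)
    rw [← div_eq_mul_inv, inv_le_comm₀ hpos (by positivity), inv_div, div_le_iff₀ (by positivity)]
    nlinarith
  have hpt : ∀ t ∈ Icc 0 L,
      (distToBdry X (γ t))⁻¹ ≤ 3 * A * ((w + t)⁻¹ + (w + (L - t))⁻¹) := by
    intro t ht
    have hm := hmin t ht
    have h1 : 0 < w + t := by linarith [ht.1]
    have h2 : 0 < w + (L - t) := by linarith [ht.2]
    have h3 := inv_pos.2 h1
    have h4 := inv_pos.2 h2
    rcases le_total t (L - t) with h | h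
    · rw [min_eq_left h] at hm
      have h5 := dist_le_sub_of_lipschitzOnWith_one hγ ⟨le_rfl, hL⟩ ht ht.1
      have h6 := distToBdry_le_add_dist (γ 0) (γ t)
      refine (hlower t ht t ht.1 hm (by linarith)).trans ?_
      gcongr
      linarith
    · rw [min_eq_right h] at hm
      have h5 := dist_le_sub_of_lipschitzOnWith_one hγ ht ⟨hL, le_rfl⟩ ht.2
      have h6 := distToBdry_le_add_dist (γ L) (γ t)
      rw [dist_comm] at h6
      refine (hlower t ht (L - t) (by linarith [ht.2]) hm (by linarith)).trans ?_
      gcongr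
      linarith
  have hi₁ := hcont₁.intervalIntegrable_of_Icc (μ := MeasureTheory.volume) hL
  have hi₂ := hcont₂.intervalIntegrable_of_Icc (μ := MeasureTheory.volume) hL
  have hLℓ : L ≤ A * ℓ := hLA.trans (by gcongr)
  calc quasihyperbolic X (γ 0) (γ L)
      ≤ ∫ t in (0:ℝ)..L, (distToBdry X (γ t))⁻¹ :=
        quasihyperbolic_le_of_mem hd ⟨L, hL, γ, hγ, rfl, rfl, rfl⟩
    _ ≤ ∫ t in (0:ℝ)..L, 3 * A * ((w + t)⁻¹ + (w + (L - t))⁻¹) :=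
        intervalIntegral.integral_mono_on hL
          (intervalIntegrable_inv_distToBdry_comp hd hγ le_rfl hL le_rfl)
          ((hi₁.add hi₂).const_mul _) hpt
    _ = 6 * A * Real.log (1 + L / w) := by
        rw [intervalIntegral.integral_const_mul, intervalIntegral.integral_add hi₁ hi₂,
          intervalIntegral.integral_comp_sub_left (fun t => (w + t)⁻¹), sub_self, sub_zero,
          integral_inv_add_eq_log hw hL]
        ring
    _ ≤ 6 * A * Real.log (1 + A * ℓ / w) := by
        gcongr

/-- A curve almost minimizing the quasihyperbolic length almost minimizes it on subintervals. -/
theorem IsUniformMS.integral_le_quasihyperbolic_add {A ε : ℝ} (hXA : IsUniformMS X A)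
    (hd : ∀ x : X, 0 < distToBdry X x) {γ : ℝ → X} {L : ℝ}
    (hγ : LipschitzOnWith 1 γ (Icc 0 L))
    (hmin : ∫ τ in (0:ℝ)..L, (distToBdry X (γ τ))⁻¹ ≤ quasihyperbolic X (γ 0) (γ L) + ε)
    {s t : ℝ} (hs : 0 ≤ s) (hst : s ≤ t) (ht : t ≤ L) :
    ∫ τ in s..t, (distToBdry X (γ τ))⁻¹ ≤ quasihyperbolic X (γ s) (γ t) + ε := by
  have h1 := quasihyperbolic_le_of_mem hd
    (integral_mem_quasihyperbolicLengths hγ le_rfl hs (hst.trans ht))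
  have h2 := quasihyperbolic_le_of_mem hd
    (integral_mem_quasihyperbolicLengths hγ (hs.trans hst) ht le_rfl)
  have h3 := hXA.quasihyperbolic_triangle hd (γ 0) (γ s) (γ L)
  have h4 := hXA.quasihyperbolic_triangle hd (γ s) (γ t) (γ L)
  have h5 := intervalIntegral.integral_add_adjacent_intervals
    (intervalIntegrable_inv_distToBdry_comp hd hγ le_rfl hs (hst.trans ht))
    (intervalIntegrable_inv_distToBdry_comp hd hγ hs hst ht)
  have h6 := intervalIntegral.integral_add_adjacent_intervals
    (intervalIntegrable_inv_distToBdry_comp hd hγ le_rfl (hs.trans hst) ht)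
    (intervalIntegrable_inv_distToBdry_comp hd hγ (hs.trans hst) ht le_rfl)
  linarith

end Quasihyperbolic

/-- If a continuous positive function satisfies `v - u ≤ C * S` whenever it is bounded by `S` on
`[u, v]` and is at least `S / 4` at both end points, then the end point condition can be dropped
at the price of doubling the constant. -/
theorem sub_le_two_mul_of_quarter_endpoints {f : ℝ → ℝ} {L C : ℝ} (hC : 0 ≤ C)
    (hf : ContinuousOn f (Icc 0 L)) (hpos : ∀ t ∈ Icc 0 L, 0 < f t)
    (h : ∀ S > 0, ∀ u v, 0 ≤ u → u ≤ v → v ≤ L → (∀ t ∈ Icc u v, f t ≤ S) →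
      S / 4 ≤ f u → S / 4 ≤ f v → v - u ≤ C * S)
    {S u v : ℝ} (hu : 0 ≤ u) (huv : u ≤ v) (hv : v ≤ L) (hS : ∀ t ∈ Icc u v, f t ≤ S) :
    v - u ≤ 2 * C * S := by
  obtain ⟨t₀, ht₀, hmin⟩ :=
    isCompact_Icc.exists_isMinOn (nonempty_Icc.2 (hu.trans (huv.trans hv))) hf
  have hm := hpos t₀ ht₀
  have key : ∀ n : ℕ, ∀ S u v, S < 4 ^ n * f t₀ → 0 ≤ u → u ≤ v → v ≤ L →
      (∀ t ∈ Icc u v, f t ≤ S) → v - u ≤ 2 * C * S := by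
    intro n
    induction n with
    | zero =>
      intro S u v hSn hu huv hv hS
      have h1 := hS u ⟨le_rfl, huv⟩
      have h2 : f t₀ ≤ f u := hmin ⟨hu, huv.trans hv⟩
      linarith
    | succ n ih =>
      intro S u v hSn hu huv hv hS
      have hsub : Icc u v ⊆ Icc 0 L := Icc_subset_Icc hu hv
      have hSpos : 0 < S := (hpos u (hsub ⟨le_rfl, huv⟩)).trans_le (hS u ⟨le_rfl, huv⟩)
      have hquarter : S / 4 < 4 ^ n * f t₀ := by
        rw [pow_succ] at hSn
        linarith
      have hCS : 0 ≤ C * S := by positivity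
      set T := Icc u v ∩ f ⁻¹' Ici (S / 4)
      have hTc : IsCompact T := isCompact_Icc.of_isClosed_subset
        ((hf.mono hsub).preimage_isClosed_of_isClosed isClosed_Icc isClosed_Ici) inter_subset_left
      rcases T.eq_empty_or_nonempty with hTe | hTn
      · have : ∀ t ∈ Icc u v, f t ≤ S / 4 := by
          intro t ht
          by_contra! hlt
          exact (hTe ▸ (⟨ht, hlt.le⟩ : t ∈ T) : t ∈ (∅ : Set ℝ))
        linarith [ih (S / 4) u v hquarter hu huv hv this]
      obtain ⟨b, ⟨hb, hfb⟩, hbmin⟩ := hTc.exists_isLeast hTn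
      obtain ⟨c, ⟨hc, hfc⟩, hcmax⟩ := hTc.exists_isGreatest hTn
      have hbc : b ≤ c := hbmin ⟨hc, hfc⟩
      have hmid := h S hSpos b c (hu.trans hb.1) hbc (hc.2.trans hv)
        (fun t ht => hS t ⟨hb.1.trans ht.1, ht.2.trans hc.2⟩) hfb hfc
      have hleft : b - u ≤ C * S / 2 := by
        by_contra! hlt
        set b' := (b + u + C * S / 2) / 2 with hb'
        have := ih (S / 4) u b' hquarter hu (by linarith) (by linarith [hb.2]) fun t ht => by
          by_contra! hft
          have : b ≤ t := hbmin ⟨⟨ht.1, by linarith [ht.2, hb.2]⟩, hft.le⟩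
          linarith [ht.2]
        linarith
      have hright : v - c ≤ C * S / 2 := by
        by_contra! hlt
        set c' := (c + v - C * S / 2) / 2 with hc'
        have := ih (S / 4) c' v hquarter (by linarith [hc.1]) (by linarith) hv fun t ht => by
          by_contra! hft
          have : t ≤ c := hcmax ⟨⟨by linarith [ht.1, hc.1], ht.2⟩, hft.le⟩
          linarith [ht.1]
        linarith
      linarith
  obtain ⟨n, hn⟩ := pow_unbounded_of_one_lt (S / f t₀) (by norm_num : (1:ℝ) < 4)
  exact key n S u v ((div_lt_iff₀ hm).1 hn) hu huv hv hS

theorem exists_forall_le_of_le_log {K c e : ℝ} (hK : 0 < K) (hc : 0 < c) :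
    ∃ C, 0 ≤ C ∧ ∀ z, 0 ≤ z → z ≤ K * Real.log (1 + c * z) + e → z ≤ C := by
  refine ⟨max 0 (2 * (K * (1 / (2 * K * c) - 1 - Real.log (1 / (2 * K * c))) + e)),
    le_max_left _ _, fun z hz h => le_max_of_le_right ?_⟩
  set δ := 1 / (2 * K * c) with hδ
  have hδpos : 0 < δ := by positivity
  have hpos : 0 < 1 + c * z := by positivity
  have h1 := Real.log_le_sub_one_of_pos (mul_pos hδpos hpos)
  rw [Real.log_mul hδpos.ne' hpos.ne'] at h1
  have h2 : K * Real.log (1 + c * z) ≤ K * (δ * (1 + c * z) - 1 - Real.log δ) := by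
    gcongr
    linarith
  have h3 : K * (δ * (c * z)) = z / 2 := by
    rw [hδ]
    field_simp
  linarith

section Uniform

variable {X : Type u} [MetricSpace X]

/-- Along almost minimizing curves in a uniform space, the length of the parameter interval is
controlled by the largest distance to the boundary. -/
theorem IsUniformMS.exists_sub_le_mul_of_almost_minimizing {A : ℝ} (hA : 1 ≤ A)
    (hXA : IsUniformMS X A) (hd : ∀ x : X, 0 < distToBdry X x) :
    ∃ C > 0, ∀ (γ : ℝ → X) (L : ℝ), LipschitzOnWith 1 γ (Icc 0 L) →
      ∫ τ in (0:ℝ)..L, (distToBdry X (γ τ))⁻¹ ≤ quasihyperbolic X (γ 0) (γ L) + 1 →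
      ∀ S u v, 0 ≤ u → u ≤ v → v ≤ L → (∀ t ∈ Icc u v, distToBdry X (γ t) ≤ S) →
        v - u ≤ C * S := by
  obtain ⟨C, hC, hlog⟩ := exists_forall_le_of_le_log (K := 6 * A) (c := 4 * A) (e := 1)
    (by positivity) (by positivity)
  refine ⟨2 * (C + 1), by positivity, fun γ L hγ hmin S u v hu huv hv hS => ?_⟩
  refine sub_le_two_mul_of_quarter_endpoints (by positivity : 0 ≤ C + 1)
    (continuous_distToBdry.comp_continuousOn hγ.continuousOn) (fun t _ => hd (γ t)) ?_ hu huv hv hS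
  intro S hSpos u v hu huv hv hS hfu hfv
  have hlow : (v - u) / S ≤ ∫ τ in u..v, (distToBdry X (γ τ))⁻¹ := by
    have := intervalIntegral.integral_mono_on huv
      (intervalIntegrable_const (c := S⁻¹) (μ := MeasureTheory.volume))
      (intervalIntegrable_inv_distToBdry_comp hd hγ hu huv hv)
      (fun t ht => inv_anti₀ (hd _) (hS t ht))
    rwa [intervalIntegral.integral_const, smul_eq_mul, ← div_eq_mul_inv] at this
  have hup := hXA.quasihyperbolic_le_log hA hd (by positivity : 0 < S / 4) hfu hfv
    (dist_le_sub_of_lipschitzOnWith_one hγ ⟨hu, huv.trans hv⟩ ⟨hu.trans huv, hv⟩ huv)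
  have hsub := hXA.integral_le_quasihyperbolic_add hd hγ hmin hu huv hv
  have hz : A * (v - u) / (S / 4) = 4 * A * ((v - u) / S) := by
    field_simp
  rw [hz] at hup
  have := hlog ((v - u) / S) (div_nonneg (by linarith) hSpos.le) (by linarith)
  rw [div_le_iff₀ hSpos] at this
  nlinarith

/-- An almost quasihyperbolic geodesic leaving a small neighbourhood of a boundary point `a`
passes, at scale `R`, through a point whose distance to the boundary is comparable to `R`. -/
theorem IsUniformMS.exists_almost_between {A : ℝ} (hA : 1 ≤ A)
    (hXA : IsUniformMS X A) (hd : ∀ x : X, 0 < distToBdry X x) :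
    ∃ c > 0, ∀ (a : UniformSpace.Completion X) (R : ℝ) (x p : X), 0 < R →
      dist (x : UniformSpace.Completion X) a < R / 2 →
      R < dist (p : UniformSpace.Completion X) a →
      ∃ u : X, dist (u : UniformSpace.Completion X) a ≤ R ∧ c * R ≤ distToBdry X u ∧
        quasihyperbolic X x u + quasihyperbolic X u p ≤ quasihyperbolic X x p + 1 := by
  obtain ⟨C, hC, hlen⟩ := hXA.exists_sub_le_mul_of_almost_minimizing hA hd
  refine ⟨1 / (2 * C), by positivity, fun a R x p hR hx hp => ?_⟩
  obtain ⟨r, ⟨L, hL, γ, hγ, rfl, rfl, rfl⟩, hr⟩ :=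
    exists_lt_of_csInf_lt (hXA.quasihyperbolicLengths_nonempty x p)
      (show quasihyperbolic X x p < quasihyperbolic X x p + 1 by linarith)
  set g : ℝ → ℝ := fun t => dist (γ t : UniformSpace.Completion X) a with hg
  have hgc : ContinuousOn g (Icc 0 L) :=
    (continuous_id.dist continuous_const).comp_continuousOn
      ((UniformSpace.Completion.continuous_coe X).comp_continuousOn hγ.continuousOn)
  set T := Icc 0 L ∩ g ⁻¹' Ici R
  have hTc : IsCompact T := isCompact_Icc.of_isClosed_subset
    (hgc.preimage_isClosed_of_isClosed isClosed_Icc isClosed_Ici) inter_subset_left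
  obtain ⟨t, ⟨ht, htR⟩, htmin⟩ := hTc.exists_isLeast ⟨L, ⟨hL, le_rfl⟩, hp.le⟩
  have htR : R ≤ g t := htR
  have hbefore : ∀ s ∈ Ico 0 t, g s < R := by
    intro s hs
    by_contra! hsR
    have : t ≤ s := htmin ⟨⟨hs.1, hs.2.le.trans ht.2⟩, hsR⟩
    linarith [hs.2]
  have htlen : R / 2 < t := by
    have h1 := dist_le_sub_of_lipschitzOnWith_one hγ ⟨le_rfl, hL⟩ ht ht.1
    rw [← UniformSpace.Completion.dist_eq, dist_comm] at h1
    have h2 : g t ≤ _ := dist_triangle (γ t : UniformSpace.Completion X) (γ 0) a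
    linarith
  have hex : ∃ s ∈ Ico 0 t, 1 / (2 * C) * R ≤ distToBdry X (γ s) := by
    by_contra! hcon
    have h1 := hlen γ L hγ hr.le (1 / (2 * C) * R) 0 ((t + R / 2) / 2) le_rfl (by linarith)
      (by linarith [ht.2]) fun s hs => (hcon s ⟨hs.1, by linarith [hs.2]⟩).le
    have h2 : C * (1 / (2 * C) * R) = R / 2 := by
      field_simp
    linarith
  obtain ⟨s, hs, hsd⟩ := hex
  have hsL : s ≤ L := hs.2.le.trans ht.2
  refine ⟨γ s, (hbefore s hs).le, hsd, ?_⟩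
  have h1 := quasihyperbolic_le_of_mem hd
    (integral_mem_quasihyperbolicLengths hγ le_rfl hs.1 hsL)
  have h2 := quasihyperbolic_le_of_mem hd
    (integral_mem_quasihyperbolicLengths hγ hs.1 hsL le_rfl)
  have h3 := intervalIntegral.integral_add_adjacent_intervals
    (intervalIntegrable_inv_distToBdry_comp hd hγ le_rfl hs.1 hsL)
    (intervalIntegrable_inv_distToBdry_comp hd hγ hs.1 hsL le_rfl)
  linarith

end Uniform

/-- quasihyperbolic Gromov products blow up near a finite
boundary point of an unbounded uniform space. -/
theorem quasihyperbolic_gromovProd_tendsto_atTop_near_boundary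
    {X : Type u} [MetricSpace X] (A : ℝ) (hA : 1 ≤ A)
    (hub : IsUnbounded X) (hXA : IsUniformMS X A)
    (hd : ∀ x : X, 0 < distToBdry X x) (p : X)
    (a : UniformSpace.Completion X)
    (ha : a ∈ (Set.range ((↑) : X → UniformSpace.Completion X))ᶜ) :
    ∀ M > (0:ℝ), ∃ r > (0:ℝ), ∀ x y : X,
      dist (x : UniformSpace.Completion X) a < r →
      dist (y : UniformSpace.Completion X) a < r →
      gromovProd (quasihyperbolic X) p x y ≥ M := by
  intro M hM
  obtain ⟨c, hc, hbetween⟩ := hXA.exists_almost_between hA hd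
  set K := 6 * A * Real.log (1 + A * 2 / c)
  have hD : 0 < dist (p : UniformSpace.Completion X) a :=
    (hd p).trans_le (distToBdry_le_dist ha p)
  set R := min (dist (p : UniformSpace.Completion X) a / 2)
    (distToBdry X p * Real.exp (-(M + 1 + K / 2)))
  have hRpos : 0 < R := lt_min (by linarith) (mul_pos (hd p) (Real.exp_pos _))
  have hRp : R < dist (p : UniformSpace.Completion X) a :=
    (min_le_left _ _).trans_lt (by linarith)
  have hfar : ∀ u : X, dist (u : UniformSpace.Completion X) a ≤ R →
      M + 1 + K / 2 ≤ quasihyperbolic X u p := by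
    intro u hu
    refine le_trans ?_ (hXA.log_div_le_quasihyperbolic hd u p)
    rw [Real.le_log_iff_exp_le (div_pos (hd p) (hd u)), le_div_iff₀ (hd u)]
    calc Real.exp (M + 1 + K / 2) * distToBdry X u
        ≤ Real.exp (M + 1 + K / 2) * (distToBdry X p * Real.exp (-(M + 1 + K / 2))) := by
          gcongr
          exact (distToBdry_le_dist ha u).trans (hu.trans (min_le_right _ _))
      _ = distToBdry X p := by
          rw [mul_left_comm, ← Real.exp_add, add_neg_cancel, Real.exp_zero, mul_one]
  refine ⟨R / 2, by linarith, fun x y hx hy => ?_⟩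
  obtain ⟨u, hua, hud, hu⟩ := hbetween a R x p hRpos hx hRp
  obtain ⟨v, hva, hvd, hv⟩ := hbetween a R y p hRpos hy hRp
  have huv : quasihyperbolic X u v ≤ K := by
    have hdist : dist u v ≤ 2 * R := by
      rw [← UniformSpace.Completion.dist_eq]
      linarith [dist_triangle_right (u : UniformSpace.Completion X) v a]
    have h := hXA.quasihyperbolic_le_log hA hd (by positivity : 0 < c * R) hud hvd hdist
    rwa [show A * (2 * R) / (c * R) = A * 2 / c by field_simp] at h
  have h1 := hXA.quasihyperbolic_triangle hd x u y
  have h2 := hXA.quasihyperbolic_triangle hd u v y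
  rw [quasihyperbolic_comm v y] at h2
  have h3 := hfar u hua
  have h4 := hfar v hva
  unfold gromovProd
  linarith

end
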